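/- Let k ≥ 1 be an integer, let α_i = -1 + 2i/k for i = 0,…,k, let μ ∈ ℝ and σ > 0, and let p̃_i = Φ_{μ,σ}(α_i) − Φ_{μ,σ}(α_{i−1}). If 1 ≤ i ≤ k−1 and α_{i−1} < μ < α_i, then p̃_i > p̃_{i+1}. -/

import Mathlib

open MeasureTheory ProbabilityTheory

/-- `Phi μ σ t` is the CDF of the normal distribution `N(μ, σ²)` evaluated at `t`. -/
noncomputable def Phi (μ σ : ℝ) (t : ℝ) : ℝ :=
  ((gaussianReal μ (σ ^ 2).toNNReal) (Set.Iic t)).toReal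

lemma continuous_gaussianPDFReal (μ : ℝ) (v : NNReal) : Continuous (gaussianPDFReal μ v) := by
  rw [gaussianPDFReal_def]
  fun_prop

lemma gaussianPDFReal_lt_of_abs_lt {μ : ℝ} {v : NNReal} (hv : v ≠ 0) {x y : ℝ}
    (h : |x - μ| < |y - μ|) : gaussianPDFReal μ v y < gaussianPDFReal μ v x := by
  have hv' : (0 : ℝ) < v := by positivity
  have hsq : (x - μ) ^ 2 < (y - μ) ^ 2 := sq_lt_sq.mpr h
  simp only [gaussianPDFReal_def]
  gcongr

lemma Phi_sub_Phi {μ σ : ℝ} (hσ : 0 < σ) (a b : ℝ) :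
    Phi μ σ b - Phi μ σ a = ∫ x in a..b, gaussianPDFReal μ (σ ^ 2).toNNReal x := by
  have hv : (σ ^ 2).toNNReal ≠ 0 := (Real.toNNReal_pos.mpr (pow_pos hσ 2)).ne'
  have hPhi (t : ℝ) : Phi μ σ t = ∫ x in Set.Iic t, gaussianPDFReal μ (σ ^ 2).toNNReal x := by
    rw [Phi, gaussianReal_apply_eq_integral μ hv, ENNReal.toReal_ofReal]
    exact integral_nonneg fun x => gaussianPDFReal_nonneg _ _ x
  rw [hPhi, hPhi]
  exact intervalIntegral.integral_Iic_sub_Iic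
    (integrable_gaussianPDFReal _ _).integrableOn (integrable_gaussianPDFReal _ _).integrableOn

/-- Of two adjacent intervals of equal length to the right of `a`, the left one has more mass
under a normal distribution whose mean lies to the left of their common endpoint. -/
lemma Phi_sub_Phi_lt {μ σ : ℝ} (hσ : 0 < σ) {a b c : ℝ} (hab : a < b) (hbc : c - b = b - a)
    (hμ : μ < b) : Phi μ σ c - Phi μ σ b < Phi μ σ b - Phi μ σ a := by
  have hv : (σ ^ 2).toNNReal ≠ 0 := (Real.toNNReal_pos.mpr (pow_pos hσ 2)).ne'
  have hcont := continuous_gaussianPDFReal μ (σ ^ 2).toNNReal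
  have hlt {x : ℝ} (hx : x < b) :
      gaussianPDFReal μ (σ ^ 2).toNNReal (2 * b - x) < gaussianPDFReal μ (σ ^ 2).toNNReal x := by
    apply gaussianPDFReal_lt_of_abs_lt hv
    rw [abs_of_pos (by linarith : 0 < 2 * b - x - μ), abs_lt]
    constructor <;> linarith
  rw [Phi_sub_Phi hσ, Phi_sub_Phi hσ]
  have hreflect : ∫ x in a..b, gaussianPDFReal μ (σ ^ 2).toNNReal (2 * b - x) =
      ∫ x in b..c, gaussianPDFReal μ (σ ^ 2).toNNReal x := by
    rw [intervalIntegral.integral_comp_sub_left]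
    congr 1 <;> linarith
  rw [← hreflect]
  refine intervalIntegral.integral_lt_integral_of_continuousOn_of_le_of_exists_lt hab
    (by fun_prop) (by fun_prop) (fun x hx => ?_) ⟨a, Set.left_mem_Icc.mpr hab.le, hlt hab⟩
  rcases hx.2.lt_or_eq with h | rfl
  · exact (hlt h).le
  · rw [two_mul, add_sub_cancel_right]

theorem stmt_4 (k : ℕ) (hk : 1 ≤ k) (μ σ : ℝ) (hσ : 0 < σ)
    (α : ℕ → ℝ) (hα : ∀ i, α i = -1 + 2 * (i : ℝ) / (k : ℝ))
    (ptilde : ℕ → ℝ)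
    (hpt : ∀ i, ptilde i = Phi μ σ (α i) - Phi μ σ (α (i - 1)))
    (i : ℕ) (hi1 : 1 ≤ i) (hik : i + 1 ≤ k)
    (hμ1 : α (i - 1) < μ) (hμ2 : μ < α i) :
    ptilde i > ptilde (i + 1) := by
  rw [hpt, hpt, Nat.add_sub_cancel]
  refine Phi_sub_Phi_lt hσ (hμ1.trans hμ2) ?_ hμ2
  rw [hα, hα, hα, Nat.cast_sub hi1]
  push_cast
  ring
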